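/- Let L ≥ 1, let B ∈ ℝ^{L×L} satisfy ∑_{l=0}^{L−1} b_{l,m}² = 1 for every m, let α_l ≥ 0 for all l, and let σ² > 0. Define the density-evolution sequences by sir_m(0) = 0 and, for i ≥ 1, sir_m(i) = ∑_l b_{l,m}²/(σ² + α_l ∑_{m'} b_{l,m'}²·mmse(sir_{m'}(i−1))). Then for every m, the bit error rate sequence i ↦ Q(√(sir_m(i))) is nonincreasing, where Q(x) = ∫_x^∞ (2π)^{−1/2} e^{−t²/2} dt is the standard Gaussian upper tail probability; in particular Q(√(sir_m(0))) = 1/2. -/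

import Mathlib

/-- The minimum mean-squared error of the BPSK-input real AWGN channel with
signal-to-noise ratio `s`. -/
noncomputable def mmse (s : ℝ) : ℝ :=
  1 - ∫ z : ℝ,
    Real.tanh (s + Real.sqrt s * z) * ((Real.sqrt (2 * Real.pi))⁻¹ * Real.exp (-z ^ 2 / 2))

/-- The upper tail probability of the standard real Gaussian distribution:
`Q(x) = ∫_x^∞ (2π)^{−1/2} e^{−t²/2} dt`. -/
noncomputable def Qfun (x : ℝ) : ℝ :=
  ∫ t in Set.Ioi x, (Real.sqrt (2 * Real.pi))⁻¹ * Real.exp (-t ^ 2 / 2)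

open MeasureTheory ProbabilityTheory in
lemma aux_mmse_integral (s : ℝ) :
    mmse s = 1 - ∫ z, Real.tanh (s + Real.sqrt s * z) ∂(gaussianReal 0 1) := by
  unfold mmse
  rw [integral_gaussianReal_eq_integral_smul one_ne_zero]
  congr 2
  funext z
  simp [gaussianPDFReal]
  ring

lemma aux_tanh_eq (x : ℝ) : Real.tanh x = 2 / (1 + Real.exp (-2 * x)) - 1 := by
  rw [Real.tanh_eq]
  have h : Real.exp (-2 * x) = Real.exp (-x) * Real.exp (-x) := by
    rw [← Real.exp_add]; ring_nf
  have h2 : Real.exp x * Real.exp (-x) = 1 := by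
    rw [← Real.exp_add]; simp
  have h3 := Real.exp_pos x
  have h4 := Real.exp_pos (-x)
  rw [h]
  set a := Real.exp x
  set b := Real.exp (-x)
  have h5 : 0 < 1 + b * b := by positivity
  field_simp
  linear_combination (2 * b) * h2

lemma aux_tanh_cont : Continuous Real.tanh := by
  have : Real.tanh = fun x => 2 / (1 + Real.exp (-2 * x)) - 1 := funext aux_tanh_eq
  rw [this]
  refine Continuous.sub (Continuous.div continuous_const (by fun_prop) ?_) continuous_const
  intro x
  positivity

open MeasureTheory in
lemma aux_tanh_int {Ω : Type*} [MeasurableSpace Ω] (μ : Measure Ω) [IsProbabilityMeasure μ]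
    (f : Ω → ℝ) (hf : Measurable f) : Integrable (fun z => Real.tanh (f z)) μ := by
  refine Integrable.of_bound (C := 1)
    ((aux_tanh_cont.measurable.comp hf).aestronglyMeasurable) ?_
  filter_upwards with z
  exact (Real.abs_tanh_lt_one _).le

lemma aux_mmse_nonneg (s : ℝ) : 0 ≤ mmse s := by
  rw [aux_mmse_integral]
  have : ∫ z, Real.tanh (s + Real.sqrt s * z) ∂(ProbabilityTheory.gaussianReal 0 1)
      ≤ ∫ z, (1 : ℝ) ∂(ProbabilityTheory.gaussianReal 0 1) := by
    refine MeasureTheory.integral_mono (aux_tanh_int _ _ (by fun_prop))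
      (MeasureTheory.integrable_const _) ?_
    intro z
    exact (Real.tanh_lt_one _).le
  simp at this
  linarith

open MeasureTheory ProbabilityTheory in
lemma aux_mmse_gauss (s : NNReal) :
    mmse s = 1 - ∫ z, Real.tanh z ∂(gaussianReal s s) := by
  rw [aux_mmse_integral]
  have h : gaussianReal (s : ℝ) s
      = (gaussianReal 0 1).map (fun z => (s : ℝ) + Real.sqrt s * z) := by
    have : (fun z : ℝ => (s : ℝ) + Real.sqrt s * z)
        = (fun z => (s : ℝ) + z) ∘ (fun z => Real.sqrt s * z) := rfl
    rw [this, ← Measure.map_map (by fun_prop) (by fun_prop), gaussianReal_map_const_mul,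
      gaussianReal_map_const_add]
    congr 1
    · simp
    · ext; simp
  rw [h, integral_map (by fun_prop) aux_tanh_cont.aestronglyMeasurable]

lemma aux_tangent (x y : ℝ) :
    Real.tanh x - 2 / (1 + Real.exp (-2 * x)) ^ 2 * Real.exp (-2 * x) *
      (Real.exp (-2 * y) - 1) ≤ Real.tanh (x + y) := by
  rw [aux_tanh_eq, aux_tanh_eq, mul_add, Real.exp_add]
  have h3 := Real.exp_pos (-2 * x)
  have h4 := Real.exp_pos (-2 * y)
  set a := Real.exp (-2 * x)
  set b := Real.exp (-2 * y)
  have key : 2 / (1 + a * b) - 1 - (2 / (1 + a) - 1 - 2 / (1 + a) ^ 2 * a * (b - 1))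
      = 2 * (a * b - a) ^ 2 / ((1 + a * b) * (1 + a) ^ 2) := by
    field_simp
    ring
  have : 0 ≤ 2 * (a * b - a) ^ 2 / ((1 + a * b) * (1 + a) ^ 2) := by positivity
  linarith

open MeasureTheory ProbabilityTheory in
lemma aux_step (t : NNReal) (x : ℝ) :
    Real.tanh x ≤ ∫ y, Real.tanh (x + y) ∂(gaussianReal t t) := by
  have hm : ∫ y, Real.exp (-2 * y) ∂(gaussianReal t t) = 1 := by
    have := congrFun (mgf_id_gaussianReal (μ := (t : ℝ)) (v := t)) (-2)
    simp only [mgf, id] at this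
    rw [this, Real.exp_eq_one_iff]
    ring
  have hi : Integrable (fun y => Real.exp (-2 * y)) (gaussianReal t t) :=
    integrable_exp_mul_gaussianReal _
  have hi1 : Integrable (fun y => Real.exp (-2 * y) - 1) (gaussianReal t t) :=
    hi.sub (integrable_const _)
  have hi2 := hi1.const_mul (2 / (1 + Real.exp (-2 * x)) ^ 2 * Real.exp (-2 * x))
  have h := integral_mono ((integrable_const (Real.tanh x)).sub hi2)
    (aux_tanh_int (gaussianReal t t) (fun y => x + y) (by fun_prop)) (fun y => aux_tangent x y)
  refine le_trans (le_of_eq ?_) h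
  simp only [Pi.sub_apply]
  rw [integral_sub (integrable_const _) hi2, integral_const_mul,
    integral_sub hi (integrable_const _), hm]
  simp

open MeasureTheory ProbabilityTheory in
lemma aux_mmse_anti {s t : ℝ} (hs : 0 ≤ s) (hst : s ≤ t) : mmse t ≤ mmse s := by
  lift s to NNReal using hs
  obtain ⟨d, rfl⟩ : ∃ d : NNReal, t = ((s + d : NNReal) : ℝ) :=
    ⟨(t - s).toNNReal, by rw [NNReal.coe_add, Real.coe_toNNReal _ (by linarith)]; ring⟩
  rw [aux_mmse_gauss, aux_mmse_gauss]
  have hconv : gaussianReal ((s + d : NNReal) : ℝ) (s + d)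
      = ((gaussianReal s s).prod (gaussianReal d d)).map (fun p => p.1 + p.2) := by
    rw [NNReal.coe_add, ← gaussianReal_conv_gaussianReal]
    rfl
  have hint := aux_tanh_int ((gaussianReal s s).prod (gaussianReal d d))
    (fun p => p.1 + p.2) (by fun_prop)
  rw [hconv, integral_map (by fun_prop) aux_tanh_cont.aestronglyMeasurable,
    integral_prod _ hint]
  have := integral_mono (aux_tanh_int (gaussianReal s s) id measurable_id)
    hint.integral_prod_left (fun x => aux_step d x)
  simp only [id] at this
  linarith

lemma aux_int : MeasureTheory.Integrable
    (fun t : ℝ => (Real.sqrt (2 * Real.pi))⁻¹ * Real.exp (-t ^ 2 / 2)) := by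
  have := (integrable_exp_neg_mul_sq (b := 1 / 2) (by norm_num)).const_mul
    (Real.sqrt (2 * Real.pi))⁻¹
  refine this.congr ?_
  filter_upwards with t
  ring_nf

lemma aux_Q_anti : Antitone Qfun := by
  intro x y hxy
  unfold Qfun
  refine MeasureTheory.setIntegral_mono_set aux_int.integrableOn ?_ ?_
  · filter_upwards with t
    simp only [Pi.zero_apply]
    positivity
  · exact (Set.Ioi_subset_Ioi hxy).eventuallyLE

lemma aux_Q_zero : Qfun 0 = 1 / 2 := by
  unfold Qfun
  rw [MeasureTheory.integral_const_mul]
  have h := integral_gaussian_Ioi (1 / 2)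
  have e : (fun x : ℝ => Real.exp (-(1 / 2) * x ^ 2)) = fun x => Real.exp (-x ^ 2 / 2) := by
    funext x; ring_nf
  rw [e] at h
  rw [h]
  have : Real.pi / (1 / 2) = 2 * Real.pi := by ring
  rw [this]
  have : 0 < Real.sqrt (2 * Real.pi) := by positivity
  field_simp

/-- **The bit error rate of density evolution is nonincreasing in the iteration
index.** For the DE recursion `sir_m(0) = 0`,
`sir_m(i) = ∑_l b_{l,m}²/(σ² + α_l ∑_{m'} b_{l,m'}²·mmse(sir_{m'}(i−1)))`, the BER
sequence `i ↦ Q(√(sir_m(i)))` is nonincreasing for every `m`, and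
`Q(√(sir_m(0))) = 1/2`. -/
theorem de_ber_antitone (L : ℕ) (hL : 1 ≤ L) (B : Fin L → Fin L → ℝ)
    (hB : ∀ m : Fin L, ∑ l : Fin L, (B l m) ^ 2 = 1)
    (α : Fin L → ℝ) (hα : ∀ l, 0 ≤ α l) (σ2 : ℝ) (hσ2 : 0 < σ2)
    (sir : ℕ → Fin L → ℝ)
    (hsir0 : ∀ m, sir 0 m = 0)
    (hsir : ∀ i m, sir (i + 1) m =
      ∑ l : Fin L,
        (B l m) ^ 2 / (σ2 + α l * ∑ m' : Fin L, (B l m') ^ 2 * mmse (sir i m'))) :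
    (∀ m : Fin L, Antitone fun i : ℕ => Qfun (Real.sqrt (sir i m))) ∧
    (∀ m : Fin L, Qfun (Real.sqrt (sir 0 m)) = 1 / 2) := by
  have hD : ∀ i l, 0 ≤ α l * ∑ m' : Fin L, (B l m') ^ 2 * mmse (sir i m') := fun i l =>
    mul_nonneg (hα l) (Finset.sum_nonneg fun m' _ =>
      mul_nonneg (sq_nonneg _) (aux_mmse_nonneg _))
  have hnn : ∀ i m, 0 ≤ sir i m := by
    intro i m
    cases i with
    | zero => rw [hsir0]
    | succ i =>
      rw [hsir]
      exact Finset.sum_nonneg fun l _ => div_nonneg (sq_nonneg _) (by linarith [hD i l])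
  have hmono : ∀ i m, sir i m ≤ sir (i + 1) m := by
    intro i
    induction i with
    | zero => intro m; rw [hsir0]; exact hnn _ _
    | succ i ih =>
      intro m
      rw [hsir i, hsir (i + 1)]
      refine Finset.sum_le_sum fun l _ => ?_
      refine div_le_div_of_nonneg_left (sq_nonneg _) (by linarith [hD (i + 1) l]) ?_
      have : ∑ m' : Fin L, (B l m') ^ 2 * mmse (sir (i + 1) m')
          ≤ ∑ m' : Fin L, (B l m') ^ 2 * mmse (sir i m') :=
        Finset.sum_le_sum fun m' _ =>
          mul_le_mul_of_nonneg_left (aux_mmse_anti (hnn i m') (ih m')) (sq_nonneg _)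
      have := mul_le_mul_of_nonneg_left this (hα l)
      linarith
  refine ⟨fun m => antitone_nat_of_succ_le fun i => ?_, fun m => ?_⟩
  · exact aux_Q_anti (Real.sqrt_le_sqrt (hmono i m))
  · rw [hsir0, Real.sqrt_zero, aux_Q_zero]
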